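/- (Theorem 1, Case 1.) Suppose both the cloned key and the original key store the same challenge hash c : α, and consider a protocol trace starting from the empty window whose send values are pairwise distinct. If the attacker's respond c operation occurs earlier in the trace than the user's respond c operation and the attacker's respond succeeds, then the user's respond c fails; that is, when the user next authenticates, the relying party detects the cloning attack. -/

import Mathlib

/-- Remove items from the head of `l` up to and including the first occurrence
of `c`; if `c ∉ l`, the result is `[]`. -/
def removeThrough {α : Type*} [DecidableEq α] (c : α) (l : List α) : List α :=
  (l.dropWhile (fun x => decide (x ≠ c))).tail

/-- An operation in a protocol trace: the relying party sends a challenge hash,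
or an authenticator responds with a stored challenge hash. -/
inductive Op (α : Type*) where
  | send (c : α)
  | respond (c : α)

/-- One step of the relying party's window update. A `send c` appends `c` to the
window; a `respond c` succeeds iff `c` is in the window, in which case the window
is updated to `removeThrough c`; a failed respond leaves the window unchanged. -/
def step {α : Type*} [DecidableEq α] (w : List α) (o : Op α) : List α :=
  match o with
  | .send c => w ++ [c]
  | .respond c => if c ∈ w then removeThrough c w else w

/-- The window after processing a whole trace from initial window `init`. -/
def window {α : Type*} [DecidableEq α] (init : List α) (t : List (Op α)) : List α :=
  t.foldl step init

/-- The list of values of the `send` operations of a trace, in order. -/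
def sends {α : Type*} : List (Op α) → List α :=
  List.filterMap (fun o => match o with | .send c => some c | .respond _ => none)

theorem removeThrough_sublist {α : Type*} [DecidableEq α] (c : α) (l : List α) :
    (removeThrough c l).Sublist l :=
  (List.tail_sublist _).trans (List.dropWhile_sublist _)

theorem notMem_removeThrough {α : Type*} [DecidableEq α] (c : α) {l : List α}
    (hl : l.Nodup) : c ∉ removeThrough c l := by
  induction l with
  | nil => simp [removeThrough]
  | cons a l ih =>
    rw [List.nodup_cons] at hl
    by_cases h : a = c
    · subst h
      simpa [removeThrough] using hl.1
    · simpa [removeThrough, List.dropWhile_cons, h] using ih hl.2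

theorem sends_append {α : Type*} (s t : List (Op α)) :
    sends (s ++ t) = sends s ++ sends t :=
  List.filterMap_append

theorem window_sublist {α : Type*} [DecidableEq α] (init : List α) (t : List (Op α)) :
    (window init t).Sublist (init ++ sends t) := by
  induction t generalizing init with
  | nil => simp [window, sends]
  | cons o t ih =>
    refine (ih (step init o)).trans ?_
    cases o with
    | send a => simp [step, sends]
    | respond a =>
      simp only [step, sends, List.filterMap_cons]
      split_ifs
      · exact (removeThrough_sublist a init).append_right _
      · exact List.Sublist.refl _

/-- After a successful `respond c`, the value `c` does not return to the window,
since it is not sent again. -/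
theorem notMem_window_of_respond {α : Type*} [DecidableEq α] {c : α} {s r : List (Op α)}
    (hnd : (sends (s ++ Op.respond c :: r)).Nodup) (hc : c ∈ window [] s) :
    c ∉ window [] (s ++ Op.respond c :: r) := by
  have hs : (window [] s).Sublist (sends s) := window_sublist [] s
  have hsr : (sends s ++ sends r).Nodup := by
    rw [sends_append] at hnd
    exact hnd
  have hw : window [] (s ++ Op.respond c :: r) =
      window (removeThrough c (window [] s)) r := by
    simp only [window, List.foldl_append, List.foldl_cons] at hc ⊢
    simp only [step, if_pos hc]
  rw [hw]
  intro h
  rcases List.mem_append.1 ((window_sublist _ r).subset h) with h | h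
  · exact notMem_removeThrough c (hsr.of_append_left.sublist hs) h
  · exact List.disjoint_of_nodup_append hsr (hs.subset hc) h

/-- Theorem 1, Case 1: if the attacker's `respond c` (at position `i`) occurs
before the user's `respond c` (at position `j`) and the attacker's respond
succeeds, then the user's respond fails: the relying party detects the clone. -/
theorem stmt_5 {α : Type*} [DecidableEq α] (t : List (Op α))
    (hnd : (sends t).Nodup) (c : α) (i j : ℕ) (hij : i < j)
    (hatk : t[i]? = some (Op.respond c)) (husr : t[j]? = some (Op.respond c))
    (hsucc : c ∈ window [] (t.take i)) :
    c ∉ window [] (t.take j) := by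
  have ht : t.take j = t.take i ++ Op.respond c :: (t.take j).drop (i + 1) := by
    obtain ⟨hi, hget⟩ := List.getElem?_eq_some_iff.1 hatk
    have hi' : i < (t.take j).length := by
      rw [List.length_take]
      omega
    conv_lhs => rw [← List.take_append_drop i (t.take j), List.drop_eq_getElem_cons hi']
    simp [List.take_take, hget, hij.le]
  have hnd' : (sends (t.take j)).Nodup := hnd.sublist ((List.take_sublist j t).filterMap _)
  rw [ht] at hnd' ⊢
  exact notMem_window_of_respond hnd' hsucc
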